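/- Let G be a group whose center contains independent elements z_1, ..., z_k (i.e., they generate a free abelian subgroup of rank k), and suppose for each nontrivial central element z there exists a finite-index subgroup of G isomorphic to G' × ℤ with z corresponding to a generator of the ℤ-factor. Then there exists a finite-index subgroup of G isomorphic to a direct product G'' × ℤ^k, under which identification the ℤ^k-factor is generated by elements z_1^{m_1}, ..., z_k^{m_k} for some integers m_i ≥ 1. -/

import Mathlib

/-- If `w` is central and lies in a finite-index subgroup `H`, then any homomorphism
`φ : H → ℤ` that is nonzero at `w` transfers to a homomorphism on `G` that is nonzero at `w`. -/
lemma exists_hom_int_ne_one_of_finiteIndex {G : Type*} [Group G] {w : G}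
    (hw : w ∈ Subgroup.center G) (H : Subgroup G) [H.FiniteIndex] (hwH : w ∈ H)
    (φ : H →* Multiplicative ℤ) (hφ : φ ⟨w, hwH⟩ ≠ 1) :
    ∃ ψ : G →* Multiplicative ℤ, ψ w ≠ 1 := by
  have key : ∀ (n : ℕ) (g₀ : G), g₀⁻¹ * w ^ n * g₀ ∈ H → g₀⁻¹ * w ^ n * g₀ = w ^ n := by
    intro n g₀ _
    rw [mul_assoc, ← Subgroup.mem_center_iff.mp (pow_mem hw n) g₀, inv_mul_cancel_left]
  refine ⟨φ.transfer, ?_⟩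
  rw [MonoidHom.transfer_eq_pow φ w key]
  have hpow : (⟨w ^ H.index, MonoidHom.transfer_eq_pow_aux w key⟩ : H) = ⟨w, hwH⟩ ^ H.index :=
    Subtype.ext rfl
  rw [hpow, map_pow]
  intro h
  have h' : H.index • (φ ⟨w, hwH⟩).toAdd = 0 := congrArg Multiplicative.toAdd h
  rcases smul_eq_zero.mp h' with h0 | h0
  · exact Subgroup.FiniteIndex.index_ne_zero h0
  · exact hφ (Multiplicative.toAdd.injective h0)

/-- A subgroup of `ℤ^ι` that is not orthogonal to any nonzero integer vector contains a positive
multiple of every standard basis vector. -/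
lemma exists_pos_smul_single_mem {ι : Type*} [Fintype ι] [DecidableEq ι]
    (N : AddSubgroup (ι → ℤ))
    (hN : ∀ n : ι → ℤ, n ≠ 0 → ∃ v ∈ N, ∑ i, n i * v i ≠ 0) (i : ι) :
    ∃ d : ℕ, 0 < d ∧ Pi.single i (d : ℤ) ∈ N := by
  let c : (ι → ℤ) → ι → ℚ := fun v j => (v j : ℚ)
  let S : Submodule ℚ (ι → ℚ) := Submodule.span ℚ (c '' N)
  have hS : S = ⊤ := by
    by_contra hne
    obtain ⟨f, hf, hfS⟩ := Submodule.exists_le_ker_of_lt_top S (lt_top_iff_ne_top.mpr hne)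
    obtain ⟨b, hb⟩ := IsLocalization.exist_integer_multiples_of_finite (nonZeroDivisors ℤ)
      (fun j => f (Pi.single j 1))
    choose n hn using hb
    have hb0 : ((b : ℤ) : ℚ) ≠ 0 := by
      exact_mod_cast nonZeroDivisors.coe_ne_zero b
    have hn' : ∀ j, (n j : ℚ) = (b : ℤ) * f (Pi.single j 1) := by
      intro j
      simpa using hn j
    have hfv : ∀ v : ι → ℚ, f v = ∑ j, v j * f (Pi.single j 1) := by
      intro v
      conv_lhs => rw [pi_eq_sum_univ' v]
      simp [map_sum]
    have hn0 : n ≠ 0 := by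
      rintro rfl
      apply hf
      ext v
      have : f (Pi.single v 1) = 0 := by
        simpa [hb0] using (hn' v).symm
      simpa using this
    obtain ⟨v, hvN, hv⟩ := hN n hn0
    apply hv
    have h0 : f (c v) = 0 := hfS (Submodule.subset_span ⟨v, hvN, rfl⟩)
    rw [hfv] at h0
    have : ((∑ j, n j * v j : ℤ) : ℚ) = 0 := by
      push_cast
      simp_rw [hn', mul_assoc, ← Finset.mul_sum]
      rw [mul_eq_zero]
      right
      rw [← h0]
      exact Finset.sum_congr rfl fun j _ => mul_comm _ _
    exact_mod_cast this
  have hmem : ∀ x ∈ S, ∃ d : ℕ, 0 < d ∧ ∃ v ∈ N, c v = (d : ℚ) • x := by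
    intro x hx
    induction hx using Submodule.span_induction with
    | mem x hx =>
      obtain ⟨v, hv, rfl⟩ := hx
      exact ⟨1, one_pos, v, hv, by simp⟩
    | zero => exact ⟨1, one_pos, 0, N.zero_mem, by ext; simp [c]⟩
    | add x y _ _ hx hy =>
      obtain ⟨d, hd, v, hv, hvx⟩ := hx
      obtain ⟨d', hd', v', hv', hvx'⟩ := hy
      refine ⟨d * d', Nat.mul_pos hd hd', d' • v + d • v',
        N.add_mem (N.nsmul_mem hv _) (N.nsmul_mem hv' _), ?_⟩
      ext j
      have h1 : (v j : ℚ) = d * x j := congrFun hvx j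
      have h2 : (v' j : ℚ) = d' * y j := congrFun hvx' j
      simp only [c, Pi.add_apply, Pi.smul_apply, Int.nsmul_eq_mul, smul_eq_mul]
      push_cast
      rw [h1, h2]
      ring
    | smul q x _ hx =>
      obtain ⟨d, hd, v, hv, hvx⟩ := hx
      refine ⟨d * q.den, Nat.mul_pos hd q.den_pos, q.num • v, N.zsmul_mem hv _, ?_⟩
      ext j
      have h1 : (v j : ℚ) = d * x j := congrFun hvx j
      simp only [c, Pi.smul_apply, smul_eq_mul]
      push_cast
      rw [h1, ← Rat.mul_den_eq_num]
      ring
  obtain ⟨d, hd, v, hv, hvx⟩ := hmem (Pi.single i 1) (hS ▸ Submodule.mem_top)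
  refine ⟨d, hd, ?_⟩
  convert hv using 1
  ext j
  have h1 : (v j : ℚ) = d * (Pi.single i 1 : ι → ℚ) j := congrFun hvx j
  have h2 : (((Pi.single i (d : ℤ) : ι → ℤ) j : ℤ) : ℚ) = v j := by
    rw [h1]
    by_cases hij : j = i
    · subst hij
      simp
    · simp [hij]
  exact_mod_cast h2

section CentralZPowHom

open scoped IsMulCommutative

/-- The homomorphism `ℤ^ι → G`, `n ↦ ∏ i, z i ^ n i`, attached to a family of central elements. -/
def centralZPowHom {G ι : Type*} [Group G] [Fintype ι] (z : ι → Subgroup.center G) :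
    Multiplicative (ι → ℤ) →* G :=
  (Subgroup.center G).subtype.comp
    { toFun := fun n => ∏ i, z i ^ n.toAdd i
      map_one' := by simp
      map_mul' := fun a b => by simp [zpow_add, Finset.prod_mul_distrib] }

lemma centralZPowHom_mem_center {G ι : Type*} [Group G] [Fintype ι]
    (z : ι → Subgroup.center G) (n : Multiplicative (ι → ℤ)) :
    centralZPowHom z n ∈ Subgroup.center G :=
  SetLike.coe_mem _

lemma centralZPowHom_single {G ι : Type*} [Group G] [Fintype ι] [DecidableEq ι]
    (z : ι → Subgroup.center G) (i : ι) :
    centralZPowHom z (Multiplicative.ofAdd (Pi.single i 1)) = z i := by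
  simp [centralZPowHom, Pi.single_apply, apply_ite, Finset.prod_ite_eq']

lemma centralZPowHom_eq_prod_ofFn {G : Type*} [Group G] {k : ℕ}
    (z : Fin k → Subgroup.center G) (n : Fin k → ℤ) :
    centralZPowHom z (Multiplicative.ofAdd n) = (List.ofFn fun i => (z i : G) ^ n i).prod := by
  simp [centralZPowHom, ← List.prod_ofFn, List.map_ofFn, Function.comp_def]

lemma toAdd_map_centralZPowHom {G ι : Type*} [Group G] [Fintype ι]
    (z : ι → Subgroup.center G) (ψ : G →* Multiplicative ℤ) (n : Multiplicative (ι → ℤ)) :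
    (ψ (centralZPowHom z n)).toAdd = ∑ i, n.toAdd i * (ψ (z i)).toAdd := by
  have h : ψ (centralZPowHom z n) = ∏ i, ψ (z i) ^ n.toAdd i := by
    change (ψ.comp (Subgroup.center G).subtype) (∏ i, z i ^ n.toAdd i) = _
    simp
  rw [h, toAdd_prod]
  simp

end CentralZPowHom

/-- If `ψ i (z j) = d i * δ i j` with `d i > 0` for central `z i`, then the common kernel of the
`ψ i` together with the `z i` generates a finite-index subgroup, which is their direct product. -/
lemma exists_finiteIndex_mulEquiv_prod {G ι : Type*} [Group G] [Fintype ι] [DecidableEq ι]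
    (z : ι → Subgroup.center G) (ψ : ι → G →* Multiplicative ℤ) (d : ι → ℕ)
    (hd : ∀ i, 0 < d i)
    (hψ : ∀ i j, (ψ i (z j)).toAdd = (Pi.single i (d i : ℤ) : ι → ℤ) j) :
    ∃ H A : Subgroup G, H.FiniteIndex ∧ ∃ e : H ≃* A × Multiplicative (ι → ℤ),
      ∀ i, ∃ hzi : (z i : G) ∈ H, e ⟨z i, hzi⟩ = (1, Multiplicative.ofAdd (Pi.single i 1)) := by
  have hψζ : ∀ i n, (ψ i (centralZPowHom z n)).toAdd = n.toAdd i * d i := by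
    intro i n
    simp [toAdd_map_centralZPowHom, hψ, Pi.single_apply]
  let A : Subgroup G := ⨅ i, (ψ i).ker
  have hA : ∀ a ∈ A, ∀ i, ψ i a = 1 := fun a ha i => Subgroup.mem_iInf.mp ha i
  let F : A × Multiplicative (ι → ℤ) →* G :=
    A.subtype.noncommCoprod (centralZPowHom z) fun a n =>
      Subgroup.mem_center_iff.mp (centralZPowHom_mem_center z n) a
  have hF : ∀ a n, F (a, n) = a * centralZPowHom z n := fun _ _ => rfl
  have hinj : Function.Injective F := by
    rw [injective_iff_map_eq_one]
    rintro ⟨a, n⟩ h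
    rw [hF] at h
    have hn : n = 1 := by
      apply Multiplicative.toAdd.injective
      ext i
      have h1 := congrArg (fun g => (ψ i g).toAdd) h
      simp only [map_mul, hA a a.2 i, one_mul, hψζ, map_one, toAdd_one] at h1
      simpa [(hd i).ne'] using h1
    subst hn
    simpa using h
  let r : G →* ∀ i, Multiplicative (ZMod (d i)) :=
    MonoidHom.pi fun i => (AddMonoidHom.toMultiplicative (Int.castAddHom (ZMod (d i)))).comp (ψ i)
  have : ∀ i, NeZero (d i) := fun i => ⟨(hd i).ne'⟩
  have : ∀ i, Finite (Multiplicative (ZMod (d i))) := fun i =>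
    inferInstanceAs (Finite (ZMod (d i)))
  have hle : r.ker ≤ F.range := by
    intro g hg
    have hdvd : ∀ i, (d i : ℤ) ∣ (ψ i g).toAdd := fun i =>
      (ZMod.intCast_zmod_eq_zero_iff_dvd _ _).mp (congrFun (MonoidHom.mem_ker.mp hg) i)
    choose q hq using hdvd
    let n : Multiplicative (ι → ℤ) := Multiplicative.ofAdd q
    refine ⟨(⟨g * (centralZPowHom z n)⁻¹, Subgroup.mem_iInf.mpr fun i => ?_⟩, n), ?_⟩
    · rw [MonoidHom.mem_ker, map_mul, map_inv, mul_inv_eq_one]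
      apply Multiplicative.toAdd.injective
      rw [hψζ, hq, mul_comm]
      rfl
    · simp [hF]
  refine ⟨F.range, A, Subgroup.finiteIndex_of_le hle, (MonoidHom.ofInjective hinj).symm,
    fun i => ?_⟩
  have hFi : F (1, Multiplicative.ofAdd (Pi.single i 1)) = z i := by
    simp [hF, centralZPowHom_single]
  refine ⟨⟨_, hFi⟩, ?_⟩
  rw [MulEquiv.symm_apply_eq]
  exact Subtype.ext hFi.symm

/-- If `z 1, …, z k` are independent central elements of `G` (they
generate a free abelian subgroup of rank `k`), and every nontrivial central element
virtually splits off a `ℤ`-factor (Ivanov–Kapovitch), then some finite-index subgroup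
of `G` is isomorphic to `A × ℤ^k` with the `ℤ^k`-factor generated by the images of
`z i ^ m i` for integers `m i ≥ 1`. -/
theorem stmt_1 {G : Type*} [Group G] (k : ℕ) (z : Fin k → G)
    (hz : ∀ i, z i ∈ Subgroup.center G)
    (hind : Function.Injective fun n : Fin k → ℤ => (List.ofFn fun i => z i ^ n i).prod)
    (hsplit : ∀ w : G, w ∈ Subgroup.center G → w ≠ 1 →
      ∃ (H A : Subgroup G), H.FiniteIndex ∧
        ∃ (e : H ≃* A × Multiplicative ℤ) (hw : w ∈ H),
          e ⟨w, hw⟩ = (1, Multiplicative.ofAdd 1)) :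
    ∃ (H A : Subgroup G), H.FiniteIndex ∧
      ∃ (e : H ≃* A × Multiplicative (Fin k → ℤ)) (m : Fin k → ℤ),
        (∀ i, 1 ≤ m i) ∧
        ∀ i, ∃ hzi : z i ^ m i ∈ H,
          e ⟨z i ^ m i, hzi⟩ = (1, Multiplicative.ofAdd (Pi.single i 1)) := by
  let zc : Fin k → Subgroup.center G := fun i => ⟨z i, hz i⟩
  let N : AddSubgroup (Fin k → ℤ) :=
    { carrier := {v | ∃ ψ : G →* Multiplicative ℤ, ∀ i, (ψ (z i)).toAdd = v i}
      zero_mem' := ⟨1, fun _ => rfl⟩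
      add_mem' := by
        rintro v v' ⟨ψ, h⟩ ⟨ψ', h'⟩
        exact ⟨ψ * ψ', fun i => by simp [h, h']⟩
      neg_mem' := by
        rintro v ⟨ψ, h⟩
        exact ⟨ψ⁻¹, fun i => by simp [h]⟩ }
  have hN : ∀ n : Fin k → ℤ, n ≠ 0 → ∃ v ∈ N, ∑ i, n i * v i ≠ 0 := by
    intro n hn
    have hw := centralZPowHom_mem_center zc (Multiplicative.ofAdd n)
    have hw1 : centralZPowHom zc (Multiplicative.ofAdd n) ≠ 1 := by
      rw [centralZPowHom_eq_prod_ofFn]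
      intro h
      apply hn
      apply hind
      simpa [zc] using h
    obtain ⟨H, B, hH, e, hwH, he⟩ := hsplit _ hw hw1
    obtain ⟨ψ, hψ⟩ := exists_hom_int_ne_one_of_finiteIndex hw H hwH
      ((MonoidHom.snd B (Multiplicative ℤ)).comp e.toMonoidHom) (by
        simp only [MonoidHom.comp_apply, MulEquiv.toMonoidHom_eq_coe, MonoidHom.coe_coe, he]
        exact fun h => one_ne_zero (α := ℤ) (congrArg Multiplicative.toAdd h))
    refine ⟨fun i => (ψ (z i)).toAdd, ⟨ψ, fun _ => rfl⟩, fun h => hψ ?_⟩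
    apply Multiplicative.toAdd.injective
    rw [toAdd_map_centralZPowHom]
    exact h
  choose d hd ψ hψ using exists_pos_smul_single_mem N hN
  obtain ⟨H, A, hH, e, he⟩ := exists_finiteIndex_mulEquiv_prod zc ψ d hd hψ
  refine ⟨H, A, hH, e, 1, fun _ => le_rfl, fun i => ?_⟩
  simpa [zc] using he i
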